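/- Let 1 = t₁ < t₂ < t₃ < … denote the successive record times of σ. Then the record-time sequence is a Markov chain: for every k ≥ 1, every sequence 1 = i₁ < i₂ < … < i_k ≤ N with ℙ(t₁ = i₁, …, t_k = i_k, and there are exactly at least k records) > 0, and every j with i_k < j ≤ N, the conditional probability ℙ(t_{k+1} = j | t₁ = i₁, …, t_k = i_k) equals i_k/(j(j−1)), depending only on i_k and j. -/

import Mathlib

/-- `σ` (a permutation of `{1,…,N}`, encoded as `Equiv.Perm (Fin N)` with time
`t ∈ {1,…,N}` corresponding to index `t - 1 : Fin N`) has a record at time `t`: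
`σ(t) > σ(k)` for all `1 ≤ k < t` (so `t = 1` is always a record). -/
def RecordAt {N : ℕ} (σ : Equiv.Perm (Fin N)) (t : ℕ) : Prop :=
  ∃ h : 1 ≤ t ∧ t ≤ N, ∀ k : ℕ, ∀ hk : k < t - 1, σ ⟨k, by omega⟩ < σ ⟨t - 1, by omega⟩

open Classical in
/-- number of permutations satisfying `P` -/
noncomputable def cntP {N : ℕ} (P : Equiv.Perm (Fin N) → Prop) : ℕ :=
  ∑ σ : Equiv.Perm (Fin N), if P σ then 1 else 0

lemma cntP_eq {N : ℕ} (P : Equiv.Perm (Fin N) → Prop) : Nat.card {σ // P σ} = cntP P := by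
  classical
  rw [Nat.card_eq_fintype_card, Fintype.card_subtype, cntP, Finset.card_filter]

lemma cntP_congr {N : ℕ} {P Q : Equiv.Perm (Fin N) → Prop} (h : ∀ σ, P σ ↔ Q σ) :
    cntP P = cntP Q := by
  have : P = Q := funext fun σ => propext (h σ)
  rw [this]

lemma cntP_mul {N : ℕ} (P : Equiv.Perm (Fin N) → Prop) (g : Equiv.Perm (Fin N)) :
    cntP (fun σ => P (σ * g)) = cntP P := by
  classical
  unfold cntP
  exact Fintype.sum_equiv (Equiv.mulRight g) _ _ (fun σ => by by_cases hq : P (σ * g) <;> simp [hq])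

/-- `P` depends only on the relative order of the first `s` values. -/
def DepOn {N : ℕ} (s : ℕ) (P : Equiv.Perm (Fin N) → Prop) : Prop :=
  ∀ σ τ : Equiv.Perm (Fin N),
    (∀ a b : Fin N, a.val < s → b.val < s → (σ a < σ b ↔ τ a < τ b)) → (P σ → P τ)

lemma depOn_iff {N s : ℕ} {P : Equiv.Perm (Fin N) → Prop} (h : DepOn s P)
    (σ τ : Equiv.Perm (Fin N))
    (hh : ∀ a b : Fin N, a.val < s → b.val < s → (σ a < σ b ↔ τ a < τ b)) : P σ ↔ P τ :=
  ⟨h σ τ hh, h τ σ fun a b ha hb => (hh a b ha hb).symm⟩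

lemma record_depOn {N : ℕ} (s t : ℕ) (hts : t ≤ s) :
    DepOn s (fun σ : Equiv.Perm (Fin N) => RecordAt σ t) := by
  rintro σ τ h ⟨h1, h2⟩
  refine ⟨h1, fun k hk => ?_⟩
  rw [← h _ _ (by simp; omega) (by simp; omega)]
  exact h2 k hk

/-- embed a permutation of the first `s` positions -/
noncomputable def emb {N s : ℕ} (h : s ≤ N) : Equiv.Perm (Fin s) →* Equiv.Perm (Fin N) :=
  Equiv.Perm.viaEmbeddingHom (Fin.castLEEmb h)

lemma emb_apply {N s : ℕ} (h : s ≤ N) (g : Equiv.Perm (Fin s)) (a : Fin s) :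
    emb h g (Fin.castLE h a) = Fin.castLE h (g a) :=
  Equiv.Perm.viaEmbedding_apply g (Fin.castLEEmb h) a

lemma emb_apply_not {N s : ℕ} (h : s ≤ N) (g : Equiv.Perm (Fin s)) (a : Fin N)
    (ha : s ≤ a.val) : emb h g a = a := by
  refine Equiv.Perm.viaEmbedding_apply_of_notMem g (Fin.castLEEmb h) a ?_
  rintro ⟨x, rfl⟩
  have := x.2
  simp at ha
  omega

lemma count_fiber {N s : ℕ} (h : s ≤ N) {P : Equiv.Perm (Fin N) → Prop} (hP : DepOn s P)
    [DecidablePred P] (σ : Equiv.Perm (Fin N)) :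
    (∑ g : Equiv.Perm (Fin s), if P (σ * emb h g) then 1 else 0)
      = ∑ g : Equiv.Perm (Fin s), if P (emb h g) then 1 else 0 := by
  let f : Fin s → Fin N := fun x => σ (Fin.castLE h x)
  have hf : Function.Injective f := fun x y hxy => Fin.castLE_injective h (σ.injective hxy)
  have hmono : StrictMono (f ∘ Tuple.sort f) :=
    (Tuple.monotone_sort f).strictMono_of_injective (hf.comp (Tuple.sort f).injective)
  symm
  refine Fintype.sum_equiv (Equiv.mulLeft (Tuple.sort f)) _ _ (fun g => ?_)
  have : P (emb h g) ↔ P (σ * emb h (Tuple.sort f * g)) := by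
    apply depOn_iff hP
    intro a b ha hb
    obtain ⟨a, rfl⟩ : ∃ a' : Fin s, a = Fin.castLE h a' := ⟨⟨a, ha⟩, rfl⟩
    obtain ⟨b, rfl⟩ : ∃ b' : Fin s, b = Fin.castLE h b' := ⟨⟨b, hb⟩, rfl⟩
    rw [Equiv.Perm.mul_apply, Equiv.Perm.mul_apply, emb_apply, emb_apply, emb_apply, emb_apply]
    have := hmono.lt_iff_lt (a := g a) (b := g b)
    exact this.symm
  by_cases hq : P (emb h g)
  · rw [if_pos hq, if_pos]; exact this.mp hq
  · rw [if_neg hq, if_neg]; exact fun hc => hq (this.mpr hc)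

lemma indep {N s : ℕ} (h : s ≤ N) {P : Equiv.Perm (Fin N) → Prop} (hP : DepOn s P) :
    ∃ p : ℕ, ∀ Q : Equiv.Perm (Fin N) → Prop,
      (∀ σ g, Q (σ * emb h g) ↔ Q σ) →
      cntP (fun σ => P σ ∧ Q σ) * s.factorial = p * cntP Q := by
  classical
  refine ⟨∑ g : Equiv.Perm (Fin s), if P (emb h g) then 1 else 0, fun Q hQ => ?_⟩
  have e1 : ∑ g : Equiv.Perm (Fin s), ∑ σ : Equiv.Perm (Fin N),
      (if P (σ * emb h g) ∧ Q σ then 1 else 0) = cntP (fun σ => P σ ∧ Q σ) * s.factorial := by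
    have : ∀ g : Equiv.Perm (Fin s), ∑ σ : Equiv.Perm (Fin N),
      (if P (σ * emb h g) ∧ Q σ then 1 else 0) = cntP (fun σ => P σ ∧ Q σ) := by
      intro g
      rw [← cntP_mul (fun σ => P σ ∧ Q σ) (emb h g)]
      unfold cntP
      refine Finset.sum_congr rfl fun σ _ => ?_
      simp only [hQ]
    simp only [this]
    simp [Fintype.card_perm, mul_comm]
  rw [← e1, Finset.sum_comm]
  unfold cntP
  rw [Finset.mul_sum]
  refine Finset.sum_congr rfl fun σ _ => ?_
  by_cases hq : Q σ
  · simp only [hq, and_true, if_true, mul_one]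
    exact count_fiber h hP σ
  · simp [hq]

lemma record_iff {N s : ℕ} (h : s < N) (σ : Equiv.Perm (Fin N)) :
    RecordAt σ (s + 1) ↔ ∀ k : Fin N, k.val < s + 1 → σ k ≤ σ ⟨s, h⟩ := by
  constructor
  · rintro ⟨h1, h2⟩ k hk
    rcases Nat.lt_succ_iff_lt_or_eq.mp hk with hk | hk
    · exact (h2 k.val hk).le
    · have : k = ⟨s, h⟩ := Fin.ext hk
      rw [this]
  · intro hh
    refine ⟨⟨by omega, by omega⟩, fun k hk => ?_⟩
    refine lt_of_le_of_ne (hh ⟨k, by omega⟩ (by simp; omega)) ?_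
    intro he
    have := congrArg Fin.val (σ.injective he)
    simp at this
    omega

lemma count_record {N s : ℕ} (h : s < N) :
    (s + 1) * cntP (fun σ : Equiv.Perm (Fin N) => RecordAt σ (s + 1))
      = cntP (fun _ : Equiv.Perm (Fin N) => True) := by
  classical
  have hle : s + 1 ≤ N := h
  let A : Fin (s + 1) → Equiv.Perm (Fin N) → Prop := fun c σ =>
    ∀ k : Fin N, k.val < s + 1 → σ k ≤ σ (Fin.castLE hle c)
  have hA : ∀ c, cntP (A c) = cntP (fun σ : Equiv.Perm (Fin N) => RecordAt σ (s + 1)) := by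
    intro c
    rw [← cntP_mul (fun σ => RecordAt σ (s + 1)) (Equiv.swap (Fin.castLE hle c) ⟨s, h⟩)]
    apply cntP_congr
    intro σ
    rw [record_iff h]
    simp only [Equiv.Perm.mul_apply, Equiv.swap_apply_right]
    have key : ∀ k : Fin N, k.val < s + 1 →
        (Equiv.swap (Fin.castLE hle c) ⟨s, h⟩ k).val < s + 1 := by
      intro k hk
      rw [Equiv.swap_apply_def]
      have := c.2
      split_ifs <;> simp <;> omega
    constructor
    · intro hh k hk
      exact hh _ (key k hk)
    · intro hh k hk
      have := hh _ (key k hk)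
      rwa [Equiv.swap_apply_self] at this
  have hsum : ∑ c : Fin (s + 1), cntP (A c) = cntP (fun _ : Equiv.Perm (Fin N) => True) := by
    unfold cntP
    rw [Finset.sum_comm]
    refine Finset.sum_congr rfl fun σ _ => ?_
    obtain ⟨c, hc⟩ := Finite.exists_max (fun c : Fin (s + 1) => σ (Fin.castLE hle c))
    have hAc : A c σ := fun k hk => hc ⟨k, hk⟩
    rw [Finset.sum_eq_single c]
    · simp [hAc]
    · intro b _ hb
      rw [if_neg]
      intro hAb
      apply hb
      have h1 := hAb (Fin.castLE hle c) c.2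
      have h2 := hc b
      exact Fin.castLE_injective hle (σ.injective (le_antisymm h2 h1))
    · simp
  rw [← hsum]
  simp [hA]

lemma record_inv {N s : ℕ} (h : s < N) (σ : Equiv.Perm (Fin N)) (g : Equiv.Perm (Fin s)) :
    RecordAt (σ * emb h.le g) (s + 1) ↔ RecordAt σ (s + 1) := by
  have main : ∀ (σ : Equiv.Perm (Fin N)) (g : Equiv.Perm (Fin s)),
      RecordAt σ (s + 1) → RecordAt (σ * emb h.le g) (s + 1) := by
    intro σ g hh
    rw [record_iff h] at hh ⊢
    intro k hk
    rw [Equiv.Perm.mul_apply, Equiv.Perm.mul_apply, emb_apply_not h.le g ⟨s, h⟩ le_rfl]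
    apply hh
    by_cases hks : k.val < s
    · have : k = Fin.castLE h.le ⟨k, hks⟩ := rfl
      rw [this, emb_apply]
      have := (g ⟨k, hks⟩).2
      simp only [Fin.val_castLE]
      omega
    · rw [emb_apply_not h.le g k (by omega)]
      exact hk
  refine ⟨fun hh => ?_, main σ g⟩
  have := main _ g⁻¹ hh
  rwa [map_inv, mul_inv_cancel_right] at this

lemma core {N s : ℕ} (h : s < N) {P : Equiv.Perm (Fin N) → Prop} (hP : DepOn s P) :
    (s + 1) * cntP (fun σ => P σ ∧ RecordAt σ (s + 1)) = cntP P := by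
  obtain ⟨p, hp⟩ := indep h.le hP
  have h1 := hp (fun σ => RecordAt σ (s + 1)) (record_inv h)
  have h2 := hp (fun _ => True) (fun _ _ => Iff.rfl)
  simp only [and_true] at h2
  rw [← count_record h] at h2
  have : (s + 1) * cntP (fun σ => P σ ∧ RecordAt σ (s + 1)) * s.factorial
      = cntP P * s.factorial := by
    rw [h2, mul_assoc, h1]
    ring
  exact Nat.eq_of_mul_eq_mul_right (Nat.factorial_pos s) this

lemma core_not {N s : ℕ} (h : s < N) {P : Equiv.Perm (Fin N) → Prop} (hP : DepOn s P) :
    (s + 1) * cntP (fun σ => P σ ∧ ¬ RecordAt σ (s + 1)) = s * cntP P := by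
  classical
  have h1 := core h hP
  have h2 : cntP P = cntP (fun σ => P σ ∧ RecordAt σ (s + 1))
      + cntP (fun σ => P σ ∧ ¬ RecordAt σ (s + 1)) := by
    unfold cntP
    rw [← Finset.sum_add_distrib]
    refine Finset.sum_congr rfl fun σ _ => ?_
    by_cases a : P σ <;> by_cases b : RecordAt σ (s + 1) <;> simp [a, b]
  nlinarith

lemma norec_depOn {N r s : ℕ} {P : Equiv.Perm (Fin N) → Prop} (hP : DepOn r P) (hrs : r ≤ s) :
    DepOn s (fun σ => P σ ∧ ∀ m, r < m → m < s + 1 → ¬ RecordAt σ m) := by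
  rintro σ τ h ⟨h1, h2⟩
  refine ⟨hP σ τ (fun a b ha hb => h a b (by omega) (by omega)) h1, fun m hm1 hm2 hr => ?_⟩
  exact h2 m hm1 hm2 (record_depOn s m (by omega) τ σ (fun a b ha hb => (h a b ha hb).symm) hr)

lemma chain {N r : ℕ} {P : Equiv.Perm (Fin N) → Prop} (hP : DepOn r P) (d : ℕ)
    (hd : r + d ≤ N) :
    (r + d) * cntP (fun σ => P σ ∧ ∀ m, r < m → m < r + d + 1 → ¬ RecordAt σ m)
      = r * cntP P := by
  induction d with
  | zero =>
    congr 1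
    apply cntP_congr
    intro σ
    refine ⟨fun h => h.1, fun h => ⟨h, fun m h1 h2 => by omega⟩⟩
  | succ d ih =>
    have := core_not (s := r + d) (by omega) (norec_depOn hP (Nat.le_add_right r d))
    rw [← ih (by omega), ← this, ← add_assoc]
    congr 1
    apply cntP_congr
    intro σ
    constructor
    · rintro ⟨h1, h2⟩
      exact ⟨⟨h1, fun m a b => h2 m a (by omega)⟩, h2 _ (by omega) (by omega)⟩
    · rintro ⟨⟨h1, h2⟩, h3⟩
      refine ⟨h1, fun m a b => ?_⟩
      rcases Nat.lt_succ_iff_lt_or_eq.mp b with b | b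
      · exact h2 m a b
      · rw [b]; exact h3

lemma total {N r j : ℕ} {P : Equiv.Perm (Fin N) → Prop} (hP : DepOn r P) (hr : r < j)
    (hj : j ≤ N) :
    j * (j - 1) * cntP (fun σ => P σ ∧ RecordAt σ j ∧ ∀ m, r < m → m < j → ¬ RecordAt σ m)
      = r * cntP P := by
  obtain ⟨d, rfl⟩ : ∃ d, j = r + d + 1 := ⟨j - r - 1, by omega⟩
  have h1 := core (s := r + d) (by omega) (norec_depOn hP (Nat.le_add_right r d))
  rw [← chain hP d (by omega), ← h1]
  have : cntP (fun σ => P σ ∧ RecordAt σ (r + d + 1) ∧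
      ∀ m, r < m → m < r + d + 1 → ¬ RecordAt σ m) =
    cntP (fun σ => (P σ ∧ ∀ m, r < m → m < r + d + 1 → ¬ RecordAt σ m)
      ∧ RecordAt σ (r + d + 1)) := cntP_congr fun σ => by tauto
  rw [this, Nat.add_sub_cancel]
  ring

/-- the successive record times `1 = t₁ < t₂ < …` of a uniformly
random permutation `σ` of `{1,…,N}` form a Markov chain: for `k ≥ 1`, a strictly
increasing sequence `1 = i₁ < … < i_k ≤ N` such that the event
`E = {t₁ = i₁, …, t_k = i_k}` (i.e. the records up to time `i_k` are exactly
`i₁,…,i_k`) has positive probability, and any `j` with `i_k < j ≤ N`, the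
conditional probability `ℙ(t_{k+1} = j | E)` is `i_k/(j(j−1))`, depending only
on `i_k` and `j`.  Conditional probabilities are ratios of cardinalities, the
measure being uniform. -/
theorem stmt10 (N k : ℕ) (hk : 1 ≤ k) (i : Fin k → ℕ)
    (hmono : StrictMono i) (h1 : i ⟨0, by omega⟩ = 1) (hN : i ⟨k - 1, by omega⟩ ≤ N)
    (j : ℕ) (hj1 : i ⟨k - 1, by omega⟩ < j) (hj2 : j ≤ N)
    (hpos : 0 < Nat.card {σ : Equiv.Perm (Fin N) //
        (∀ m : Fin k, RecordAt σ (i m)) ∧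
        (∀ t, t ≤ i ⟨k - 1, by omega⟩ → RecordAt σ t → ∃ m, i m = t)}) :
    (Nat.card {σ : Equiv.Perm (Fin N) //
        ((∀ m : Fin k, RecordAt σ (i m)) ∧
          (∀ t, t ≤ i ⟨k - 1, by omega⟩ → RecordAt σ t → ∃ m, i m = t)) ∧
        RecordAt σ j ∧ ∀ m, i ⟨k - 1, by omega⟩ < m → m < j → ¬ RecordAt σ m} : ℝ)
      / (Nat.card {σ : Equiv.Perm (Fin N) //
          (∀ m : Fin k, RecordAt σ (i m)) ∧
          (∀ t, t ≤ i ⟨k - 1, by omega⟩ → RecordAt σ t → ∃ m, i m = t)} : ℝ)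
      = (i ⟨k - 1, by omega⟩ : ℝ) / ((j : ℝ) * ((j : ℝ) - 1)) := by
  have hP : DepOn (i ⟨k - 1, by omega⟩) (fun σ : Equiv.Perm (Fin N) =>
      (∀ m : Fin k, RecordAt σ (i m)) ∧
        (∀ t, t ≤ i ⟨k - 1, by omega⟩ → RecordAt σ t → ∃ m, i m = t)) := by
    rintro σ τ h ⟨h2, h3⟩
    refine ⟨fun m => record_depOn _ _ (hmono.monotone ?_) σ τ h (h2 m), fun t ht hr => ?_⟩
    · rw [Fin.le_def]
      have := m.2
      simp only
      omega
    · exact h3 t ht (record_depOn _ t ht τ σ (fun a b ha hb => (h a b ha hb).symm) hr)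
  have key := total hP hj1 hj2
  rw [cntP_eq] at hpos
  rw [cntP_eq, cntP_eq]
  generalize cntP _ = x at key ⊢
  generalize cntP _ = y at key hpos ⊢
  have hj : 2 ≤ j := by
    have := hmono.monotone (show (⟨0, by omega⟩ : Fin k) ≤ ⟨k - 1, by omega⟩ by simp)
    omega
  have hy : (y : ℝ) ≠ 0 := by positivity
  have hj' : (2 : ℝ) ≤ j := by exact_mod_cast hj
  rw [div_eq_div_iff hy (by nlinarith)]
  have := congrArg (Nat.cast : ℕ → ℝ) key
  push_cast [Nat.cast_sub (show 1 ≤ j by omega)] at this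
  linarith
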